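/- Let d ≥ 1, let (G,p) be a generic framework of G=(V,E) in ℝ^d, and suppose that the pair {x,y} is not d-linked in G for some x,y ∈ V. Let (G,q) be a framework equivalent to (G,p) whose points affinely span ℝ^d. Then (G,q) has a flexing φ : [0,1] → (ℝ^d)^V such that ‖φ(t)(x) − φ(t)(y)‖ ≠ ‖p(x) − p(y)‖ for all t ∈ (0,1]. -/

import Mathlib

open scoped BigOperators

noncomputable section

namespace Rigidity

variable {V : Type*}

/-- Euclidean distance between two points of `ℝ^d` (given as coordinate functions). -/
def eDist {d : ℕ} (x y : Fin d → ℝ) : ℝ := Real.sqrt (∑ i, (x i - y i) ^ 2)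

/-- Two frameworks `(G,p)` and `(G,q)` are equivalent if corresponding edge lengths agree. -/
def Equivalent {d : ℕ} (G : SimpleGraph V) (p q : V → Fin d → ℝ) : Prop :=
  ∀ u v : V, G.Adj u v → eDist (p u) (p v) = eDist (q u) (q v)

/-- Two placements are congruent if all pairwise distances agree. -/
def Congruent {d : ℕ} (p q : V → Fin d → ℝ) : Prop :=
  ∀ u v : V, eDist (p u) (p v) = eDist (q u) (q v)

/-- A placement is generic if the multiset of its coordinates is algebraically
independent over `ℚ`. -/
def Generic {d : ℕ} (p : V → Fin d → ℝ) : Prop :=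
  AlgebraicIndependent ℚ (fun vi : V × Fin d => p vi.1 vi.2)

/-- `{u,v}` is globally linked in the framework `(G,p)`. -/
def GloballyLinkedIn {d : ℕ} (G : SimpleGraph V) (p : V → Fin d → ℝ) (u v : V) : Prop :=
  ∀ q : V → Fin d → ℝ, Equivalent G p q → eDist (q u) (q v) = eDist (p u) (p v)

/-- `{u,v}` is globally `d`-linked in `G`. -/
def GloballyLinked (d : ℕ) (G : SimpleGraph V) (u v : V) : Prop :=
  ∀ p : V → Fin d → ℝ, Generic p → GloballyLinkedIn G p u v

/-- The framework `(G,p)` is rigid. -/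
def RigidFramework {d : ℕ} (G : SimpleGraph V) (p : V → Fin d → ℝ) : Prop :=
  ∃ ε > (0:ℝ), ∀ q : V → Fin d → ℝ, Equivalent G p q →
    (∀ v, eDist (p v) (q v) < ε) → Congruent p q

/-- `G` is `d`-rigid: every generic framework of `G` in `ℝ^d` is rigid. -/
def IsRigidGraph (d : ℕ) (G : SimpleGraph V) : Prop :=
  ∀ p : V → Fin d → ℝ, Generic p → RigidFramework G p

/-- The framework `(G,p)` is globally rigid. -/
def GloballyRigidFramework {d : ℕ} (G : SimpleGraph V) (p : V → Fin d → ℝ) : Prop :=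
  ∀ q : V → Fin d → ℝ, Equivalent G p q → Congruent p q

/-- The row of the rigidity matrix corresponding to the (ordered) edge `(u,v)`. -/
def edgeVec [DecidableEq V] {d : ℕ} (p : V → Fin d → ℝ) (u v : V) : V × Fin d → ℝ :=
  fun wi => if wi.1 = u then p u wi.2 - p v wi.2
            else if wi.1 = v then p v wi.2 - p u wi.2 else 0

/-- The rank of the set of rows of the rigidity matrix of `(·,p)` indexed by `F`. -/
def rankAt [DecidableEq V] (d : ℕ) (p : V → Fin d → ℝ) (F : Set (Sym2 V)) : ℕ :=
  Module.finrank ℝ (Submodule.span ℝ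
    {x : V × Fin d → ℝ | ∃ u v : V, s(u, v) ∈ F ∧ x = edgeVec p u v})

/-- `r_d(F)`: the rank of the set of rows indexed by `F` of the rigidity matrix of a
generic framework, equivalently the maximum of this rank over all placements. -/
def rd [DecidableEq V] (d : ℕ) (F : Set (Sym2 V)) : ℕ :=
  sSup {n : ℕ | ∃ p : V → Fin d → ℝ, n = rankAt d p F}

/-- An edge set is `ℛ_d`-independent if its rank equals its cardinality. -/
def RdIndep [DecidableEq V] (d : ℕ) (F : Set (Sym2 V)) : Prop := rd d F = F.ncard

/-- An `ℛ_d`-circuit: not independent, but every proper subset is independent. -/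
def RdCircuit [DecidableEq V] (d : ℕ) (C : Set (Sym2 V)) : Prop :=
  ¬ RdIndep d C ∧ ∀ C' : Set (Sym2 V), C' ⊂ C → RdIndep d C'

/-- An `ℛ_d`-circuit of the graph `G`. -/
def RdCircuitOf [DecidableEq V] (d : ℕ) (G : SimpleGraph V) (C : Set (Sym2 V)) : Prop :=
  C ⊆ G.edgeSet ∧ RdCircuit d C

/-- `F` is (the edge set of) an `ℛ_d`-component of `G`: an equivalence class of the
relation "`e = f` or some `ℛ_d`-circuit of `G` contains both `e` and `f`". -/
def IsRdComponent [DecidableEq V] (d : ℕ) (G : SimpleGraph V) (F : Set (Sym2 V)) : Prop :=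
  ∃ e ∈ G.edgeSet, F = {f | f ∈ G.edgeSet ∧
    (e = f ∨ ∃ C, RdCircuitOf d G C ∧ e ∈ C ∧ f ∈ C)}

/-- The set of vertices covered by an edge set. -/
def vertexSpan (F : Set (Sym2 V)) : Set V := {v | ∃ e ∈ F, v ∈ e}

/-- A nonempty edge set is `ℛ_d`-connected if any two of its edges lie on a common
`ℛ_d`-circuit contained in it (or are equal). -/
def RdConnectedSet [DecidableEq V] (d : ℕ) (F : Set (Sym2 V)) : Prop :=
  F.Nonempty ∧ ∀ e ∈ F, ∀ f ∈ F, e = f ∨ ∃ C, C ⊆ F ∧ RdCircuit d C ∧ e ∈ C ∧ f ∈ C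

/-- A graph (with at least one edge) is `ℛ_d`-connected. -/
def RdConnected [DecidableEq V] (d : ℕ) (H : SimpleGraph V) : Prop :=
  RdConnectedSet d H.edgeSet

/-- `e` is an `ℛ_d`-bridge of `G`: `r_d(E ∖ {e}) = r_d(E) − 1`. -/
def IsRdBridge [DecidableEq V] (d : ℕ) (G : SimpleGraph V) (e : Sym2 V) : Prop :=
  e ∈ G.edgeSet ∧ rd d (G.edgeSet \ {e}) + 1 = rd d G.edgeSet

/-- `G + uv`. -/
def addEdge (G : SimpleGraph V) (u v : V) : SimpleGraph V :=
  G ⊔ SimpleGraph.fromEdgeSet {s(u, v)}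

/-- `{u,v}` is `d`-linked in `G` if `r_d(G+uv) = r_d(G)`. -/
def IsLinked [DecidableEq V] (d : ℕ) (G : SimpleGraph V) (u v : V) : Prop :=
  rd d (addEdge G u v).edgeSet = rd d G.edgeSet

/-- There exist `k` pairwise internally vertex-disjoint `u`–`v` paths in `H`
(i.e. `κ_H(u,v) ≥ k`). -/
def InternallyDisjointPaths (H : SimpleGraph V) (u v : V) (k : ℕ) : Prop :=
  ∃ P : Fin k → H.Walk u v, (∀ i, (P i).IsPath) ∧
    ∀ i j, i ≠ j → ∀ w, w ∈ (P i).support → w ∈ (P j).support → w = u ∨ w = v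

/-- An unordered pair forming a 2-separator: two distinct vertices whose deletion
disconnects the graph. -/
def TwoSepPair (H : SimpleGraph V) (e : Sym2 V) : Prop :=
  ¬ e.IsDiag ∧ ¬ (H.induce {v | v ∉ e}).Connected

/-- The augmented graph `Ĥ`: add an edge for every 2-separator. -/
def aug (H : SimpleGraph V) : SimpleGraph V :=
  H ⊔ SimpleGraph.fromEdgeSet {e | TwoSepPair H e}

/-- A subgraph is 3-connected: at least 4 vertices, and deleting fewer than 3
vertices leaves it connected. -/
def IsThreeConnectedSubgraph {G : SimpleGraph V} (J : G.Subgraph) : Prop :=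
  4 ≤ J.verts.ncard ∧ ∀ S : Set V, S.ncard < 3 → (J.deleteVerts S).coe.Connected

/-- A 3-block of `H`: a maximal 3-connected subgraph of the augmented graph `Ĥ`. -/
def IsThreeBlock (H : SimpleGraph V) (J : (aug H).Subgraph) : Prop :=
  IsThreeConnectedSubgraph J ∧
    ∀ J' : (aug H).Subgraph, IsThreeConnectedSubgraph J' → J ≤ J' → J = J'

/-- `h_H(e)`: the number of 3-blocks of `H` containing both vertices of `e`. -/
def numBlocksOn (H : SimpleGraph V) (e : Sym2 V) : ℕ :=
  {J : (aug H).Subgraph | IsThreeBlock H J ∧ ∀ v ∈ e, v ∈ J.verts}.ncard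

open Classical in
/-- `k(H) = Σ (h_H(ab) − 1)` over all 2-separators `{a,b}` of `H`. -/
def kGraph [Fintype V] [DecidableEq V] (H : SimpleGraph V) : ℕ :=
  ∑ e : Sym2 V, if TwoSepPair H e then numBlocksOn H e - 1 else 0

/-- The graph of an `ℛ₂`-component, on its own vertex set. -/
def componentGraph [DecidableEq V] (F : Set (Sym2 V)) :
    SimpleGraph (vertexSpan F) :=
  (SimpleGraph.fromEdgeSet F).induce (vertexSpan F)

/-- `X` is the vertex set of an `ℛ_d`-block of `G`: a 3-block of a non-trivial
`ℛ_d`-component of `G`. -/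
def IsRdBlockVerts [DecidableEq V] (d : ℕ) (G : SimpleGraph V) (X : Set V) : Prop :=
  ∃ F : Set (Sym2 V), IsRdComponent d G F ∧ 2 ≤ F.ncard ∧
    ∃ J : (aug (componentGraph F)).Subgraph,
      IsThreeBlock (componentGraph F) J ∧ X = Subtype.val '' J.verts

/-- The globally linked closure of `G` in `ℝ^d`. -/
def glc (d : ℕ) (G : SimpleGraph V) : SimpleGraph V :=
  G ⊔ SimpleGraph.fromEdgeSet {e | ∃ u v : V, e = s(u, v) ∧ GloballyLinked d G u v}

/-- A globally `d`-linked cluster: the vertex set of a maximal complete subgraph of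
`glc_d(G)`. -/
def IsCluster (d : ℕ) (G : SimpleGraph V) (X : Set V) : Prop :=
  (∀ a ∈ X, ∀ b ∈ X, a ≠ b → (glc d G).Adj a b) ∧
    ∀ Y : Set V, X ⊆ Y → (∀ a ∈ Y, ∀ b ∈ Y, a ≠ b → (glc d G).Adj a b) → Y = X

/-- Equilibrium stress of a framework, encoded as a symmetric function vanishing on
non-edges. -/
def IsEqStress [Fintype V] {d : ℕ} (G : SimpleGraph V) (p : V → Fin d → ℝ)
    (ω : V → V → ℝ) : Prop :=
  (∀ u v, ω u v = ω v u) ∧ (∀ u v, ¬ G.Adj u v → ω u v = 0) ∧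
    ∀ u, ∑ v, ω u v • (p u - p v) = 0

/-- `{u,v}` is `d`-stress-linked in `G`. -/
def StressLinked [Fintype V] (d : ℕ) (G : SimpleGraph V) (u v : V) : Prop :=
  ∀ p : V → Fin d → ℝ, Generic p → ∀ q : V → Fin d → ℝ,
    (∀ ω, IsEqStress G p ω → IsEqStress G q ω) →
    ∀ ω, IsEqStress (addEdge G u v) p ω → IsEqStress (addEdge G u v) q ω

/-- Equivalence of complex frameworks. -/
def CEquivalent {d : ℕ} (G : SimpleGraph V) (p q : V → Fin d → ℂ) : Prop :=
  ∀ u v : V, G.Adj u v →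
    ∑ i, (p u i - p v i) ^ 2 = ∑ i, (q u i - q v i) ^ 2

/-- Generic complex placement. -/
def CGeneric {d : ℕ} (p : V → Fin d → ℂ) : Prop :=
  AlgebraicIndependent ℚ (fun vi : V × Fin d => p vi.1 vi.2)

/-- `{u,v}` is globally linked in `G` in `ℂ^d`. -/
def CGloballyLinked (d : ℕ) (G : SimpleGraph V) (u v : V) : Prop :=
  ∀ p : V → Fin d → ℂ, CGeneric p → ∀ q : V → Fin d → ℂ, CEquivalent G p q →
    ∑ i, (q u i - q v i) ^ 2 = ∑ i, (p u i - p v i) ^ 2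

/-- A flexing of the framework `(G,q)`. -/
def IsFlexing {d : ℕ} (G : SimpleGraph V) (q : V → Fin d → ℝ)
    (φ : Set.Icc (0:ℝ) 1 → V → Fin d → ℝ) : Prop :=
  Continuous φ ∧ φ ⟨0, Set.left_mem_Icc.mpr zero_le_one⟩ = q ∧
    (∀ t, Equivalent G q (φ t)) ∧
    ∀ t : Set.Icc (0:ℝ) 1, 0 < (t : ℝ) → ¬ Congruent q (φ t)

/-- A finite loopless multigraph on vertex type `V` with edge type `E`. -/
structure Multigraph (V : Type*) (E : Type*) where
  ends : E → Sym2 V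
  loopless : ∀ e, ¬ (ends e).IsDiag

/-- The data `(B, bar)` exhibits `G` as a body-bar graph induced by `H`. -/
def IsBodyBar {V E W : Type*} (H : Multigraph V E) (G : SimpleGraph W)
    (B : V → Set W) (bar : E → W × W) : Prop :=
  (∀ w : W, ∃! v : V, w ∈ B v) ∧
  (∀ v : V, (B v).ncard = {e : E | v ∈ H.ends e}.ncard) ∧
  (∀ e : E, ∃ w z : V, H.ends e = s(w, z) ∧ (bar e).1 ∈ B w ∧ (bar e).2 ∈ B z) ∧
  (∀ e : E, (bar e).1 ≠ (bar e).2) ∧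
  (∀ e e' : E, e ≠ e' →
    ({(bar e).1, (bar e).2} ∩ {(bar e').1, (bar e').2} : Set W) = ∅) ∧
  (∀ a b : W, G.Adj a b ↔ a ≠ b ∧
    ((∃ v : V, a ∈ B v ∧ b ∈ B v) ∨ ∃ e : E, s(a, b) = s((bar e).1, (bar e).2)))

/-- `P` is a partition of the set `X`. -/
def IsPartitionOf {V : Type*} (X : Set V) (P : Set (Set V)) : Prop :=
  (∀ p ∈ P, p.Nonempty ∧ p ⊆ X) ∧ ∀ v ∈ X, ∃! p, p ∈ P ∧ v ∈ p

/-- The subgraph `(X,F)` of the multigraph `H` is `k`-tree-connected. -/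
def SubTreeConnected {V E : Type*} (k : ℕ) (H : Multigraph V E)
    (X : Set V) (F : Set E) : Prop :=
  X.Nonempty ∧ (∀ e ∈ F, ∀ v ∈ H.ends e, v ∈ X) ∧
    ∀ P : Set (Set V), IsPartitionOf X P →
      k * (P.ncard - 1) ≤ {e | e ∈ F ∧ ¬ ∃ p ∈ P, ∀ v ∈ H.ends e, v ∈ p}.ncard

/-- `(X,F)` is a `k`-superbrick of `H`: a maximal `k`-tree-connected subgraph. -/
def IsSuperbrick {V E : Type*} (k : ℕ) (H : Multigraph V E)
    (X : Set V) (F : Set E) : Prop :=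
  SubTreeConnected k H X F ∧
    ∀ X' F', SubTreeConnected k H X' F' → X ⊆ X' → F ⊆ F' → X = X' ∧ F = F'

open IntermediateField.algebraAdjoinAdjoin in
/-- In characteristic zero, the differentials of the members of a transcendence basis are
linearly independent. -/
theorem linearIndependent_D_of_isTranscendenceBasis {K L ι : Type*} [Field K] [Field L]
    [Algebra K L] [CharZero K] {a : ι → L} (ha : IsTranscendenceBasis K a) :
    LinearIndependent L (fun i => KaehlerDifferential.D K L (a i)) := by
  let : Algebra (MvPolynomial ι K) L := (MvPolynomial.aeval a).toAlgebra
  have hX (P : MvPolynomial ι K) : algebraMap (MvPolynomial ι K) L P = MvPolynomial.aeval a P := rfl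
  have : IsScalarTower K (MvPolynomial ι K) L :=
    IsScalarTower.of_algebraMap_eq fun x => by simp [hX]
  have : Algebra.FormallyEtale (MvPolynomial ι K) L := by
    let e := ha.1.aevalEquiv
    let : Algebra (MvPolynomial ι K) (Algebra.adjoin K (Set.range a)) := e.toAlgHom.toAlgebra
    have : IsScalarTower (MvPolynomial ι K) (Algebra.adjoin K (Set.range a)) L :=
      IsScalarTower.of_algebraMap_eq fun x => (ha.1.algebraMap_aevalEquiv x).symm
    have : Algebra.FormallyEtale (MvPolynomial ι K) (Algebra.adjoin K (Set.range a)) :=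
      .of_equiv (AlgEquiv.ofBijective (Algebra.ofId _ _) e.bijective)
    have : Algebra.FormallyEtale (Algebra.adjoin K (Set.range a))
        (IntermediateField.adjoin K (Set.range a)) := .of_isLocalization (nonZeroDivisors _)
    have := ha.isAlgebraic_field
    have : Algebra.FormallyEtale (IntermediateField.adjoin K (Set.range a)) L :=
      .of_isSeparable _ L
    have : Algebra.FormallyEtale (Algebra.adjoin K (Set.range a)) L :=
      .comp _ (IntermediateField.adjoin K (Set.range a)) _
    exact .comp _ (Algebra.adjoin K (Set.range a)) _
  let b := (KaehlerDifferential.mvPolynomialBasis K ι).baseChange L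
  have hb := b.linearIndependent.map'
    (KaehlerDifferential.tensorKaehlerEquivOfFormallyEtale K (MvPolynomial ι K) L).toLinearMap
    (LinearEquiv.ker _)
  have heq : (fun i => KaehlerDifferential.D K L (a i)) =
      (KaehlerDifferential.tensorKaehlerEquivOfFormallyEtale K (MvPolynomial ι K) L) ∘ b := by
    ext i
    simp [b, hX]
  rw [heq]
  exact hb

/-- In characteristic zero, algebraically independent elements have linearly independent
differentials. -/
theorem linearIndependent_D_of_algebraicIndependent {K L ι : Type*} [Field K] [Field L]
    [Algebra K L] [CharZero K] {a : ι → L} (ha : AlgebraicIndependent K a) :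
    LinearIndependent L (fun i => KaehlerDifferential.D K L (a i)) := by
  obtain ⟨t, hst, ht⟩ := exists_isTranscendenceBasis_superset ha.coe_range
  have h := linearIndependent_D_of_isTranscendenceBasis ht
  exact h.comp (fun i => ⟨a i, hst ⟨i, rfl⟩⟩) fun i j hij => ha.injective (by simpa using hij)

/-- The squared Euclidean distance of two points given by their coordinates. -/
def sqDist {d : ℕ} (a b : Fin d → ℝ) : ℝ := ∑ i, (a i - b i) ^ 2

theorem eDist_eq_eDist_iff {d : ℕ} {a b a' b' : Fin d → ℝ} :
    eDist a b = eDist a' b' ↔ sqDist a b = sqDist a' b' :=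
  Real.sqrt_inj (Finset.sum_nonneg fun _ _ => sq_nonneg _)
    (Finset.sum_nonneg fun _ _ => sq_nonneg _)

theorem sqDist_comm {d : ℕ} (a b : Fin d → ℝ) : sqDist a b = sqDist b a :=
  Finset.sum_congr rfl fun _ _ => by ring

/-- The span of the rows of the rigidity matrix of a framework indexed by `F`. -/
def rowSpan [DecidableEq V] {d : ℕ} (p : V → Fin d → ℝ) (F : Set (Sym2 V)) :
    Submodule ℝ (V × Fin d → ℝ) :=
  Submodule.span ℝ {x | ∃ u v : V, s(u, v) ∈ F ∧ x = edgeVec p u v}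

theorem edgeVec_mem_rowSpan [DecidableEq V] {d : ℕ} (p : V → Fin d → ℝ) {F : Set (Sym2 V)} {u v : V}
    (h : s(u, v) ∈ F) : edgeVec p u v ∈ rowSpan p F :=
  Submodule.subset_span ⟨u, v, h, rfl⟩

theorem edgeVec_apply [DecidableEq V] {d : ℕ} (p : V → Fin d → ℝ) (u v w : V) (i : Fin d) :
    edgeVec p u v (w, i) =
      (if w = u then p u i - p v i else 0) - (if w = v then p u i - p v i else 0) := by
  unfold edgeVec
  by_cases h1 : w = u
  · subst h1
    by_cases h2 : w = v <;> simp [h2]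
  · by_cases h2 : w = v
    · subst h2
      simp [h1]
    · simp [h1, h2]

theorem edgeVec_comm [DecidableEq V] {d : ℕ} (p : V → Fin d → ℝ) (u v : V) :
    edgeVec p u v = edgeVec p v u := by
  ext ⟨w, i⟩
  rw [edgeVec_apply, edgeVec_apply]
  split_ifs <;> ring

theorem sum_edgeVec_smul [Fintype V] [DecidableEq V] {d : ℕ} {M : Type*} [AddCommGroup M]
    [Module ℝ M] (p : V → Fin d → ℝ) (u v : V) (g : V × Fin d → M) :
    ∑ k, edgeVec p u v k • g k = ∑ i, (p u i - p v i) • (g (u, i) - g (v, i)) := by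
  rw [Fintype.sum_prod_type, Finset.sum_comm]
  refine Finset.sum_congr rfl fun i _ => ?_
  simp [edgeVec_apply, sub_smul, Finset.sum_sub_distrib, ite_smul, smul_sub]

theorem D_sqDist [Fintype V] [DecidableEq V] {d : ℕ} (p : V → Fin d → ℝ) (u v : V) :
    KaehlerDifferential.D ℚ ℝ (sqDist (p u) (p v)) = (2 : ℝ) •
      Fintype.linearCombination ℝ (fun k : V × Fin d => KaehlerDifferential.D ℚ ℝ (p k.1 k.2))
        (edgeVec p u v) := by
  rw [Fintype.linearCombination_apply, sum_edgeVec_smul, sqDist, map_sum, Finset.smul_sum]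
  refine Finset.sum_congr rfl fun i _ => ?_
  rw [Derivation.leibniz_pow, map_sub]
  simp [two_smul]

/-- The rank of a generic framework does not exceed that of any equivalent framework. -/
theorem rankAt_le_rankAt_of_equivalent [Fintype V] [DecidableEq V] {d : ℕ} {G : SimpleGraph V}
    {p q : V → Fin d → ℝ} (hp : Generic p) (hq : Equivalent G p q) :
    rankAt d p G.edgeSet ≤ rankAt d q G.edgeSet := by
  let L (p : V → Fin d → ℝ) :=
    Fintype.linearCombination ℝ (fun k : V × Fin d => KaehlerDifferential.D ℚ ℝ (p k.1 k.2))
  have hinj : Function.Injective (L p) :=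
    (linearIndependent_D_of_algebraicIndependent hp).fintypeLinearCombination_injective
  have hle : (rowSpan p G.edgeSet).map (L p) ≤ (rowSpan q G.edgeSet).map (L q) := by
    rw [rowSpan, Submodule.map_span, Submodule.span_le]
    rintro _ ⟨_, ⟨u, v, huv, rfl⟩, rfl⟩
    refine ⟨edgeVec q u v, edgeVec_mem_rowSpan q huv, ?_⟩
    have h2 : (2 : ℝ) • L p (edgeVec p u v) = (2 : ℝ) • L q (edgeVec q u v) := by
      rw [← D_sqDist, ← D_sqDist, eDist_eq_eDist_iff.mp (hq u v huv)]
    exact (smul_right_injective _ two_ne_zero h2).symm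
  calc rankAt d p G.edgeSet = Module.finrank ℝ ((rowSpan p G.edgeSet).map (L p)) :=
        (LinearEquiv.finrank_eq (Submodule.equivMapOfInjective (L p) hinj _))
    _ ≤ Module.finrank ℝ ((rowSpan q G.edgeSet).map (L q)) := Submodule.finrank_mono hle
    _ ≤ rankAt d q G.edgeSet := Submodule.finrank_map_le _ _

theorem bddAbove_rankAt [Fintype V] [DecidableEq V] (d : ℕ) (F : Set (Sym2 V)) :
    BddAbove {n : ℕ | ∃ p : V → Fin d → ℝ, n = rankAt d p F} := by
  refine ⟨Module.finrank ℝ (V × Fin d → ℝ), ?_⟩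
  rintro _ ⟨p, rfl⟩
  exact Submodule.finrank_le _

theorem rankAt_le_rd [Fintype V] [DecidableEq V] {d : ℕ} (p : V → Fin d → ℝ) (F : Set (Sym2 V)) :
    rankAt d p F ≤ rd d F :=
  le_csSup (bddAbove_rankAt d F) ⟨p, rfl⟩

theorem rankAt_mono [Fintype V] [DecidableEq V] {d : ℕ} (p : V → Fin d → ℝ) {F F' : Set (Sym2 V)}
    (h : F ⊆ F') : rankAt d p F ≤ rankAt d p F' := by
  refine Submodule.finrank_mono (Submodule.span_mono ?_)
  rintro _ ⟨u, v, huv, rfl⟩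
  exact ⟨u, v, h huv, rfl⟩

/-- A family of rows of the rigidity matrix that is a basis of the span of the rows in `F`. -/
theorem exists_rows_basis [Fintype V] [DecidableEq V] {d : ℕ} (p : V → Fin d → ℝ)
    (F : Set (Sym2 V)) : ∃ b : Fin (rankAt d p F) → V × V, (∀ i, s((b i).1, (b i).2) ∈ F) ∧
      LinearIndependent ℝ (fun i => edgeVec p (b i).1 (b i).2) := by
  obtain ⟨f, hf, -, hli⟩ := Submodule.exists_fun_fin_finrank_span_eq ℝ
    {x : V × Fin d → ℝ | ∃ u v : V, s(u, v) ∈ F ∧ x = edgeVec p u v}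
  choose u v huv hx using hf
  refine ⟨fun i => (u i, v i), huv, ?_⟩
  rw [funext hx] at hli
  exact hli

theorem det_mul_transpose_ne_zero_iff {ι κ : Type*} [Fintype ι] [DecidableEq ι] [Fintype κ]
    (A : Matrix ι κ ℝ) : (A * A.transpose).det ≠ 0 ↔ LinearIndependent ℝ A.row := by
  rw [← Matrix.vecMul_injective_iff, ← Matrix.coe_vecMulLinear, injective_iff_map_eq_zero, ne_eq,
    ← Matrix.exists_vecMul_eq_zero_iff]
  have key (v : ι → ℝ) : Matrix.vecMul v (A * A.transpose) = 0 ↔ Matrix.vecMul v A = 0 := by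
    simpa using Matrix.vecMul_self_mul_conjTranspose_eq_zero A v
  push Not
  simp only [Matrix.vecMulLinear_apply, ← key]
  exact forall_congr' fun v => by tauto

/-- A polynomial in the coordinates that does not vanish at some placement does not vanish
at a generic placement. -/
theorem Generic.aeval_ne_zero {d : ℕ} {p : V → Fin d → ℝ} (hp : Generic p)
    (P : MvPolynomial (V × Fin d) ℚ) (p' : V → Fin d → ℝ)
    (h : MvPolynomial.aeval (fun k : V × Fin d => p' k.1 k.2) P ≠ 0) :
    MvPolynomial.aeval (fun k : V × Fin d => p k.1 k.2) P ≠ 0 := by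
  intro h0
  refine h ?_
  rw [(injective_iff_map_eq_zero _).mp hp P h0, map_zero]

theorem Generic.rankAt_eq_rd [Fintype V] [DecidableEq V] {d : ℕ} {p : V → Fin d → ℝ}
    (hp : Generic p) (F : Set (Sym2 V)) : rankAt d p F = rd d F := by
  refine le_antisymm (rankAt_le_rd p F) (csSup_le ⟨_, p, rfl⟩ ?_)
  rintro _ ⟨p', rfl⟩
  obtain ⟨b, hbF, hb⟩ := exists_rows_basis p' F
  let X (v : V) (i : Fin d) : MvPolynomial (V × Fin d) ℚ := MvPolynomial.X (v, i)
  let M : Matrix (Fin (rankAt d p' F)) (V × Fin d) (MvPolynomial (V × Fin d) ℚ) := .of fun j k =>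
    (if k.1 = (b j).1 then X (b j).1 k.2 - X (b j).2 k.2 else 0) -
      (if k.1 = (b j).2 then X (b j).1 k.2 - X (b j).2 k.2 else 0)
  let R (p : V → Fin d → ℝ) : Matrix (Fin (rankAt d p' F)) (V × Fin d) ℝ :=
    fun j => edgeVec p (b j).1 (b j).2
  have hM (p : V → Fin d → ℝ) :
      MvPolynomial.aeval (fun k : V × Fin d => p k.1 k.2) (M * M.transpose).det =
        (R p * (R p).transpose).det := by
    rw [AlgHom.map_det, AlgHom.mapMatrix_apply, Matrix.map_mul, Matrix.transpose_map]
    have : M.map (MvPolynomial.aeval fun k : V × Fin d => p k.1 k.2) = R p := by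
      ext j ⟨w, i⟩
      simp only [Matrix.map_apply, Matrix.of_apply, M, R, edgeVec_apply, X, map_sub,
        apply_ite (MvPolynomial.aeval _), map_zero, MvPolynomial.aeval_X]
    rw [this]
  have h1 := hp.aeval_ne_zero (M * M.transpose).det p'
    (by rw [hM]; exact (det_mul_transpose_ne_zero_iff _).mpr hb)
  rw [hM, det_mul_transpose_ne_zero_iff] at h1
  have h2 : LinearIndependent ℝ (fun j => (⟨edgeVec p (b j).1 (b j).2,
      edgeVec_mem_rowSpan p (hbF j)⟩ : rowSpan p F)) :=
    LinearIndependent.of_comp (rowSpan p F).subtype h1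
  exact (Fintype.card_fin _).ge.trans h2.fintype_card_le_finrank

open scoped Matrix

/-- The matrix of the vectors from the vertex `v₀` to the vertices `w i` in a framework. -/
def frameMatrix {d : ℕ} (p : V → Fin d → ℝ) (v₀ : V) (w : Fin d → V) :
    Matrix (Fin d) (Fin d) ℝ :=
  .of fun i => p (w i) - p v₀

theorem exists_det_frameMatrix_ne_zero {d : ℕ} {q : V → Fin d → ℝ}
    (hspan : affineSpan ℝ (Set.range q) = ⊤) :
    ∃ v₀ w, (frameMatrix q v₀ w).det ≠ 0 := by
  have hne : (Set.range q).Nonempty := by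
    rw [← affineSpan_nonempty (k := ℝ), hspan]
    exact Set.univ_nonempty
  obtain ⟨_, v₀, -⟩ := hne
  have hvec : Submodule.span ℝ (Set.range fun v => q v - q v₀) = ⊤ := by
    have := vectorSpan_range_eq_span_range_vsub_right ℝ q v₀
    rw [← direction_affineSpan, hspan, AffineSubspace.direction_top] at this
    exact this.symm
  have h := Submodule.exists_fun_fin_finrank_span_eq ℝ (Set.range fun v => q v - q v₀)
  rw [hvec, finrank_top, Module.finrank_fin_fun] at h
  obtain ⟨f, hf, -, hli⟩ := h
  choose w hw using hf
  refine ⟨v₀, w, ?_⟩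
  rw [← isUnit_iff_ne_zero, ← Matrix.isUnit_iff_isUnit_det,
    ← Matrix.linearIndependent_rows_iff_isUnit]
  rw [← funext hw] at hli
  exact hli

theorem Generic.det_frameMatrix_ne_zero {d : ℕ} {p q : V → Fin d → ℝ} (hp : Generic p) {v₀ : V}
    {w : Fin d → V} (hq : (frameMatrix q v₀ w).det ≠ 0) : (frameMatrix p v₀ w).det ≠ 0 := by
  let M : Matrix (Fin d) (Fin d) (MvPolynomial (V × Fin d) ℚ) :=
    .of fun i j => MvPolynomial.X (w i, j) - MvPolynomial.X (v₀, j)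
  have hM (p : V → Fin d → ℝ) :
      MvPolynomial.aeval (fun k : V × Fin d => p k.1 k.2) M.det = (frameMatrix p v₀ w).det := by
    rw [AlgHom.map_det, AlgHom.mapMatrix_apply]
    congr 1
    ext i j
    simp [M, frameMatrix]
  rw [← hM]
  exact hp.aeval_ne_zero _ q (by rwa [hM])

/-- The rigidity matrix of the complete framework on `V`, with a row for each ordered pair of
vertices. -/
def completeRigidityMatrix [DecidableEq V] {d : ℕ} (p : V → Fin d → ℝ) :
    Matrix (V × V) (V × Fin d) ℝ :=
  .of fun e => edgeVec p e.1 e.2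

theorem rank_completeRigidityMatrix [Fintype V] [DecidableEq V] {d : ℕ} (p : V → Fin d → ℝ) :
    (completeRigidityMatrix p).rank = rankAt d p Set.univ := by
  have h : Set.range (completeRigidityMatrix p).row =
      {x | ∃ u v : V, s(u, v) ∈ Set.univ ∧ x = edgeVec p u v} := by
    ext x
    simp only [Set.mem_range, Prod.exists, Set.mem_univ, true_and, Set.mem_ofPred_eq,
      eq_comm (a := x)]
    rfl
  rw [Matrix.rank_eq_finrank_span_row, h]
  rfl

theorem mem_ker_completeRigidityMatrix [Fintype V] [DecidableEq V] {d : ℕ} (p : V → Fin d → ℝ)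
    (m : V × Fin d → ℝ) : m ∈ LinearMap.ker (completeRigidityMatrix p).mulVecLin ↔
      ∀ u v, ∑ i, (p u i - p v i) * (m (u, i) - m (v, i)) = 0 := by
  rw [LinearMap.mem_ker, funext_iff, Prod.forall]
  refine forall_congr' fun u => forall_congr' fun v => ?_
  rw [show (completeRigidityMatrix p).mulVecLin m (u, v) = ∑ k, edgeVec p u v k • m k from rfl,
    sum_edgeVec_smul]
  rfl

/-- The framework `p` moved by the infinitesimal affine motion that agrees on the frame of `q` given
by `v₀` and `w` with the infinitesimal motion `m` of `q`. -/
def transferMotion {d : ℕ} (q p : V → Fin d → ℝ) (v₀ : V) (w : Fin d → V) :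
    (V × Fin d → ℝ) →ₗ[ℝ] (V × Fin d → ℝ) where
  toFun m k := m (v₀, k.2) + ((p k.1 - p v₀) ᵥ* ((frameMatrix q v₀ w)⁻¹ *
    frameMatrix (fun v i => m (v, i)) v₀ w)) k.2
  map_add' m m' := by
    have : frameMatrix (fun v i => (m + m') (v, i)) v₀ w =
        frameMatrix (fun v i => m (v, i)) v₀ w + frameMatrix (fun v i => m' (v, i)) v₀ w := by
      ext i j
      simp [frameMatrix]
      ring
    ext k
    rw [this, Matrix.mul_add, Matrix.vecMul_add]
    simp only [Pi.add_apply]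
    ring
  map_smul' c m := by
    have : frameMatrix (fun v i => (c • m) (v, i)) v₀ w =
        c • frameMatrix (fun v i => m (v, i)) v₀ w := by
      ext i j
      simp [frameMatrix]
      ring
    ext k
    rw [this, Matrix.mul_smul, Matrix.vecMul_smul]
    simp only [Pi.smul_apply, RingHom.id_apply, smul_add]

/-- Among complete frameworks, those that affinely span the space have maximum rank. -/
theorem rankAt_univ_le [Fintype V] [DecidableEq V] {d : ℕ} {p q : V → Fin d → ℝ} {v₀ : V}
    {w : Fin d → V} (hp : (frameMatrix p v₀ w).det ≠ 0) (hq : (frameMatrix q v₀ w).det ≠ 0) :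
    rankAt d p Set.univ ≤ rankAt d q Set.univ := by
  have hP : IsUnit (frameMatrix p v₀ w) :=
    (Matrix.isUnit_iff_isUnit_det _).mpr (isUnit_iff_ne_zero.mpr hp)
  have hQ : IsUnit (frameMatrix q v₀ w) :=
    (Matrix.isUnit_iff_isUnit_det _).mpr (isUnit_iff_ne_zero.mpr hq)
  set Q := frameMatrix q v₀ w with hQdef
  let N (m : V × Fin d → ℝ) := frameMatrix (fun v i => m (v, i)) v₀ w
  have hQA (m) : Q * (Q⁻¹ * N m) = N m := by
    rw [Matrix.mul_nonsing_inv_cancel_left _ _ (isUnit_iff_ne_zero.mpr hq)]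
  have hbil {m : V × Fin d → ℝ} (hm : m ∈ LinearMap.ker (completeRigidityMatrix q).mulVecLin)
      (u v : V) : ∑ i, (q u i - q v₀ i) * (m (v, i) - m (v₀, i)) +
        ∑ i, (q v i - q v₀ i) * (m (u, i) - m (v₀, i)) = 0 := by
    rw [mem_ker_completeRigidityMatrix] at hm
    have h1 := hm u v
    have h2 := hm u v₀
    have h3 := hm v v₀
    have : ∑ i, (q u i - q v₀ i) * (m (v, i) - m (v₀, i)) +
        ∑ i, (q v i - q v₀ i) * (m (u, i) - m (v₀, i)) =
        ∑ i, (q u i - q v₀ i) * (m (u, i) - m (v₀, i)) +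
        ∑ i, (q v i - q v₀ i) * (m (v, i) - m (v₀, i)) -
        ∑ i, (q u i - q v i) * (m (u, i) - m (v, i)) := by
      rw [← Finset.sum_add_distrib, ← Finset.sum_add_distrib, ← Finset.sum_sub_distrib]
      exact Finset.sum_congr rfl fun i _ => by ring
    rw [this, h1, h2, h3]
    ring
  have hskew {m} (hm : m ∈ LinearMap.ker (completeRigidityMatrix q).mulVecLin) :
      (Q⁻¹ * N m).transpose = -(Q⁻¹ * N m) := by
    have h0 : Q * (Q⁻¹ * N m + (Q⁻¹ * N m).transpose) * Q.transpose = 0 := by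
      rw [Matrix.mul_add, Matrix.add_mul, hQA, Matrix.mul_assoc Q, ← Matrix.transpose_mul, hQA]
      ext i j
      have := hbil hm (w i) (w j)
      simp only [Matrix.add_apply, Matrix.mul_apply, Matrix.transpose_apply, Matrix.zero_apply]
      rw [add_comm, ← this]
      congr 1
      exact Finset.sum_congr rfl fun k _ => mul_comm _ _
    have hQt : IsUnit Q.transpose := by
      rwa [Matrix.isUnit_iff_isUnit_det, Matrix.det_transpose, ← Matrix.isUnit_iff_isUnit_det]
    rw [hQt.mul_left_eq_zero, hQ.mul_right_eq_zero] at h0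
    exact eq_neg_of_add_eq_zero_right h0
  let Φ := transferMotion q p v₀ w
  have hΦ (m) (v : V) (j : Fin d) :
      Φ m (v, j) = m (v₀, j) + ((p v - p v₀) ᵥ* (Q⁻¹ * N m)) j := rfl
  have hmaps : ∀ m ∈ LinearMap.ker (completeRigidityMatrix q).mulVecLin,
      Φ m ∈ LinearMap.ker (completeRigidityMatrix p).mulVecLin := by
    intro m hm
    rw [mem_ker_completeRigidityMatrix]
    intro u v
    let A := Q⁻¹ * N m
    have hsub : (p u - p v) ᵥ* A = (p u - p v₀) ᵥ* A - (p v - p v₀) ᵥ* A := by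
      rw [← Matrix.sub_vecMul, sub_sub_sub_cancel_right]
    have h1 : ∑ i, (p u i - p v i) * (Φ m (u, i) - Φ m (v, i)) =
        (p u - p v) ⬝ᵥ ((p u - p v) ᵥ* A) := by
      refine Finset.sum_congr rfl fun i _ => ?_
      rw [hΦ, hΦ, hsub]
      simp only [Pi.sub_apply, A]
      ring
    have h2 : (p u - p v) ⬝ᵥ ((p u - p v) ᵥ* A) = -((p u - p v) ⬝ᵥ ((p u - p v) ᵥ* A)) := by
      conv_lhs => rw [dotProduct_comm, ← Matrix.dotProduct_mulVec, ← Matrix.vecMul_transpose,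
        hskew hm, Matrix.vecMul_neg, dotProduct_neg]
    rw [h1]
    linarith
  have hinj : Function.Injective (Φ.restrict hmaps) := by
    rw [injective_iff_map_eq_zero]
    rintro ⟨m, hm⟩ h0
    have hz : Φ m = 0 := congrArg Subtype.val h0
    have hv₀ (j) : m (v₀, j) = 0 := by
      have := congrFun hz (v₀, j)
      rw [hΦ] at this
      simpa using this
    have hN : N m = 0 := by
      have hPA : frameMatrix p v₀ w * (Q⁻¹ * N m) = 0 := by
        ext i j
        have := congrFun hz (w i, j)
        rw [hΦ, hv₀, zero_add] at this
        exact this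
      rw [← hQA m, hP.mul_right_eq_zero.mp hPA, Matrix.mul_zero]
    have hmv (v : V) : Q *ᵥ (fun i => m (v, i)) = 0 := by
      ext i
      have h := hbil hm v (w i)
      have hNi (k) : m (w i, k) = 0 := by
        have : m (w i, k) - m (v₀, k) = 0 := congrFun (congrFun hN i) k
        rwa [hv₀, sub_zero] at this
      simp only [hNi, mul_zero, Finset.sum_const_zero, zero_add, hv₀, sub_zero] at h
      exact h
    refine Subtype.ext (funext fun ⟨v, j⟩ => ?_)
    have := Matrix.eq_zero_of_mulVec_eq_zero hq (hmv v)
    exact congrFun this j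
  have hker := LinearMap.finrank_le_finrank_of_injective hinj
  have e1 := (completeRigidityMatrix p).mulVecLin.finrank_range_add_finrank_ker
  have e2 := (completeRigidityMatrix q).mulVecLin.finrank_range_add_finrank_ker
  rw [← rank_completeRigidityMatrix, ← rank_completeRigidityMatrix, Matrix.rank, Matrix.rank]
  omega

open Filter Topology

/-- A map with surjective derivative at `a` can be moved off the value at `a` in any direction. -/
theorem _root_.ContDiffAt.exists_curve {E F : Type*} [NormedAddCommGroup E] [NormedSpace ℝ E]
    [NormedAddCommGroup F] [NormedSpace ℝ F] [FiniteDimensional ℝ F] {H : E → F} {H' : E →L[ℝ] F}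
    {a : E} (hH : ContDiffAt ℝ 1 H a) (hH' : HasFDerivAt H H' a) (hsurj : Function.Surjective H')
    (w : F) : ∃ γ : ℝ → E, γ 0 = a ∧
      ∀ᶠ t in 𝓝 0, DifferentiableAt ℝ γ t ∧ H (γ t) = H a + t • w := by
  have : CompleteSpace F := FiniteDimensional.complete ℝ F
  obtain ⟨S₀, hS₀⟩ :=
    (H' : E →ₗ[ℝ] F).exists_rightInverse_of_surjective (LinearMap.range_eq_top.mpr hsurj)
  let S : F →L[ℝ] E := LinearMap.toContinuousLinearMap S₀
  have hS (z : F) : H' (S z) = z := LinearMap.congr_fun hS₀ z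
  have ha : a + S 0 = a := by simp
  have haff : ContDiffAt ℝ 1 (fun z => a + S z) (0 : F) := by fun_prop
  have hg : ContDiffAt ℝ 1 (fun z => H (a + S z)) (0 : F) :=
    ContDiffAt.comp (0 : F) (by rwa [ha]) haff
  have hg' : HasFDerivAt (fun z => H (a + S z)) (ContinuousLinearEquiv.refl ℝ F : F →L[ℝ] F) 0 := by
    have h1 : HasFDerivAt (fun z => a + S z) S (0 : F) := S.hasFDerivAt.const_add a
    have h2 : HasFDerivAt H H' (a + S 0) := by rwa [ha]
    have h3 : (ContinuousLinearEquiv.refl ℝ F : F →L[ℝ] F) = H'.comp S :=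
      ContinuousLinearMap.ext fun z => (hS z).symm
    rw [h3]
    exact h2.comp (0 : F) h1
  have hL := hg.to_localInverse hg' one_ne_zero
  have hL0 := hg.localInverse_apply_image hg' one_ne_zero
  have hLH : ∀ᶠ y in 𝓝 (H a), H (a + S (hg.localInverse hg' one_ne_zero y)) = y := by
    have := (hg.hasStrictFDerivAt' hg' one_ne_zero).eventually_right_inverse
    rwa [ha] at this
  set L := hg.localInverse hg' one_ne_zero
  rw [ha] at hL hL0
  have hline : ContDiff ℝ 1 fun t : ℝ => H a + t • w := by fun_prop
  have hline0 : H a + (0 : ℝ) • w = H a := by simp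
  have hlim : Tendsto (fun t : ℝ => H a + t • w) (𝓝 0) (𝓝 (H a)) := by
    simpa using hline.continuous.tendsto 0
  refine ⟨fun t => a + S (L (H a + t • w)), by simp [hL0], ?_⟩
  have hLd : ∀ᶠ y in 𝓝 (H a), DifferentiableAt ℝ L y :=
    (hL.eventually (by simp)).mono fun y hy => hy.differentiableAt one_ne_zero
  filter_upwards [hlim.eventually hLH, hlim.eventually hLd] with t h1 h2
  refine ⟨?_, h1⟩
  have h3 : DifferentiableAt ℝ (fun t : ℝ => H a + t • w) t :=
    hline.differentiable one_ne_zero t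
  exact (S.differentiableAt.comp t (h2.comp t h3)).const_add a

/-- The derivative of the squared length of `uv` at the framework `p`. -/
def sqDistDeriv {d : ℕ} [Fintype V] (p : V → Fin d → ℝ) (u v : V) : (V → Fin d → ℝ) →L[ℝ] ℝ :=
  ∑ i, (2 * (p u i - p v i)) •
    ((ContinuousLinearMap.proj i).comp
        (ContinuousLinearMap.proj (R := ℝ) (φ := fun _ => Fin d → ℝ) u) -
      (ContinuousLinearMap.proj i).comp
        (ContinuousLinearMap.proj (R := ℝ) (φ := fun _ => Fin d → ℝ) v))

theorem hasFDerivAt_sqDist {d : ℕ} [Fintype V] (p : V → Fin d → ℝ) (u v : V) :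
    HasFDerivAt (fun p : V → Fin d → ℝ => sqDist (p u) (p v)) (sqDistDeriv p u v) p := by
  unfold sqDist sqDistDeriv
  refine HasFDerivAt.fun_sum fun i _ => ?_
  have h (w : V) : HasFDerivAt (fun p : V → Fin d → ℝ => p w i)
      ((ContinuousLinearMap.proj i).comp
        (ContinuousLinearMap.proj (R := ℝ) (φ := fun _ => Fin d → ℝ) w)) p :=
    ((ContinuousLinearMap.proj i).comp
        (ContinuousLinearMap.proj (R := ℝ) (φ := fun _ => Fin d → ℝ) w)).hasFDerivAt
  simpa using ((h u).sub (h v)).pow 2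

theorem sqDistDeriv_apply {d : ℕ} [Fintype V] [DecidableEq V] (p : V → Fin d → ℝ) (u v : V)
    (m : V → Fin d → ℝ) :
    sqDistDeriv p u v m = 2 * (edgeVec p u v ⬝ᵥ fun k : V × Fin d => m k.1 k.2) := by
  have := sum_edgeVec_smul p u v fun k : V × Fin d => m k.1 k.2
  simp only [smul_eq_mul] at this
  rw [dotProduct, this, sqDistDeriv, Finset.mul_sum]
  simp [mul_assoc]

/-- If the rows of the rigidity matrix at `q` indexed by `e` are linearly independent, then the
lengths of these pairs can be prescribed arbitrarily near `q`. -/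
theorem exists_curve_sqDist {d : ℕ} [Fintype V] [DecidableEq V] {q : V → Fin d → ℝ} {ι : Type*}
    [Fintype ι] [DecidableEq ι] {e : ι → V × V}
    (he : LinearIndependent ℝ fun j => edgeVec q (e j).1 (e j).2) (w : ι → ℝ) :
    ∃ γ : ℝ → V → Fin d → ℝ, γ 0 = q ∧ ∀ᶠ t in 𝓝 0, DifferentiableAt ℝ γ t ∧
      ∀ j, sqDist (γ t (e j).1) (γ t (e j).2) = sqDist (q (e j).1) (q (e j).2) + t * w j := by
  have hsurj : Function.Surjective
      (ContinuousLinearMap.pi fun j => sqDistDeriv q (e j).1 (e j).2) := by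
    intro y
    let A : Matrix ι (V × Fin d) ℝ := .of fun j => edgeVec q (e j).1 (e j).2
    have hA := (det_mul_transpose_ne_zero_iff A).mpr he
    let z := A.transpose *ᵥ ((A * A.transpose)⁻¹ *ᵥ ((2 : ℝ)⁻¹ • y))
    have hz : A *ᵥ z = (2 : ℝ)⁻¹ • y := by
      rw [Matrix.mulVec_mulVec, Matrix.mulVec_mulVec,
        Matrix.mul_nonsing_inv _ (isUnit_iff_ne_zero.mpr hA), Matrix.one_mulVec]
    refine ⟨fun v i => z (v, i), funext fun j => ?_⟩
    have := congrFun hz j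
    rw [ContinuousLinearMap.pi_apply, sqDistDeriv_apply]
    change edgeVec q (e j).1 (e j).2 ⬝ᵥ z = _ at this
    change 2 * (edgeVec q (e j).1 (e j).2 ⬝ᵥ z) = _
    rw [this, Pi.smul_apply, smul_eq_mul, mul_inv_cancel_left₀ two_ne_zero]
  have hH : ContDiffAt ℝ 1
      (fun p : V → Fin d → ℝ => fun j => sqDist (p (e j).1) (p (e j).2)) q := by
    unfold sqDist
    fun_prop
  have hH' : HasFDerivAt (fun p : V → Fin d → ℝ => fun j => sqDist (p (e j).1) (p (e j).2))
      (ContinuousLinearMap.pi fun j => sqDistDeriv q (e j).1 (e j).2) q :=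
    hasFDerivAt_pi.mpr fun j => hasFDerivAt_sqDist q _ _
  obtain ⟨γ, h0, hγ⟩ := hH.exists_curve hH' hsurj w
  exact ⟨γ, h0, hγ.mono fun t ht => ⟨ht.1, congrFun ht.2⟩⟩

theorem continuous_edgeVec {d : ℕ} [DecidableEq V] (u v : V) :
    Continuous fun p : V → Fin d → ℝ => edgeVec p u v := by
  refine continuous_pi fun ⟨w, i⟩ => ?_
  simp only [edgeVec_apply]
  split_ifs <;> fun_prop

/-- If the framework `(G, q)` has maximum rank and the row of `uv` is independent of the rows of its
edges, then `(G, q)` can be moved so that the squared length of `uv` changes at unit speed. -/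
theorem exists_motion {d : ℕ} [Fintype V] [DecidableEq V] {G : SimpleGraph V} {q : V → Fin d → ℝ}
    (hq : rankAt d q G.edgeSet = rd d G.edgeSet) {u v : V}
    (huv : edgeVec q u v ∉ rowSpan q G.edgeSet) :
    ∃ γ : ℝ → V → Fin d → ℝ, γ 0 = q ∧ ∀ᶠ t in 𝓝 0, ContinuousAt γ t ∧
      (∀ a b, G.Adj a b → sqDist (γ t a) (γ t b) = sqDist (q a) (q b)) ∧
      sqDist (γ t u) (γ t v) = sqDist (q u) (q v) + t := by
  obtain ⟨e, heG, he⟩ := exists_rows_basis q G.edgeSet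
  have hspan_le (p : V → Fin d → ℝ) : Submodule.span ℝ (Set.range fun j =>
      edgeVec p (e j).1 (e j).2) ≤ rowSpan p G.edgeSet := by
    rw [Submodule.span_le]
    rintro _ ⟨j, rfl⟩
    exact edgeVec_mem_rowSpan p (heG j)
  let e' : Option (Fin (rankAt d q G.edgeSet)) → V × V := fun o => o.elim (u, v) e
  have he' : LinearIndependent ℝ fun o => edgeVec q (e' o).1 (e' o).2 :=
    linearIndependent_option.mpr ⟨he, fun h => huv (hspan_le q h)⟩
  obtain ⟨γ, h0, hγ⟩ := exists_curve_sqDist he' fun o => if o = none then 1 else 0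
  refine ⟨γ, h0, ?_⟩
  have hcont : ContinuousAt γ 0 := hγ.self_of_nhds.1.continuousAt
  have hind : ∀ᶠ t in 𝓝 0, LinearIndependent ℝ fun j => edgeVec (γ t) (e j).1 (e j).2 := by
    have hc : ContinuousAt (fun t => fun j => edgeVec (γ t) (e j).1 (e j).2) 0 :=
      continuousAt_pi.mpr fun j => (continuous_edgeVec _ _).continuousAt.comp hcont
    refine hc.eventually (isOpen_setOfPred_linearIndependent.mem_nhds ?_)
    simpa [h0] using he
  have hmain := hγ.and hind
  obtain ⟨r, hr, hball⟩ := Metric.eventually_nhds_iff_ball.mp hmain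
  filter_upwards [Metric.ball_mem_nhds (0 : ℝ) hr] with t ht
  refine ⟨(hball t ht).1.1.continuousAt, fun a b hab => ?_,
    by simpa [e'] using (hball t ht).1.2 none⟩
  have hderiv (x : V × V) {s : ℝ} (hs : s ∈ Metric.ball 0 r) :
      HasDerivAt (fun t => sqDist (γ t x.1) (γ t x.2))
        (sqDistDeriv (γ s) x.1 x.2 (deriv γ s)) s :=
    (hasFDerivAt_sqDist (γ s) x.1 x.2).comp_hasDerivAt s (hball s hs).1.1.hasDerivAt
  have hconst := Metric.isOpen_ball.is_const_of_deriv_eq_zero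
    (convex_ball (0 : ℝ) r).isPreconnected
    (fun s hs => (hderiv (a, b) hs).differentiableAt.differentiableWithinAt) (fun s hs => ?_)
    ht (Metric.mem_ball_self hr)
  · simpa [h0] using hconst
  rw [(hderiv (a, b) hs).deriv, Pi.zero_apply, sqDistDeriv_apply, mul_eq_zero]
  right
  have hspan : Submodule.span ℝ (Set.range fun j => edgeVec (γ s) (e j).1 (e j).2) =
      rowSpan (γ s) G.edgeSet := by
    refine Submodule.eq_of_le_of_finrank_le (hspan_le _) ?_
    rw [finrank_span_eq_card (hball s hs).2, Fintype.card_fin, hq]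
    exact rankAt_le_rd _ _
  have hmem : edgeVec (γ s) a b ∈ Submodule.span ℝ (Set.range fun j =>
      edgeVec (γ s) (e j).1 (e j).2) := by
    rw [hspan]
    exact edgeVec_mem_rowSpan _ hab
  generalize edgeVec (γ s) a b = z at hmem ⊢
  induction hmem using Submodule.span_induction with
  | mem x hx =>
    obtain ⟨j, rfl⟩ := hx
    have hz : HasDerivAt (fun t => sqDist (γ t (e j).1) (γ t (e j).2)) 0 s := by
      refine (hasDerivAt_const s (sqDist (q (e j).1) (q (e j).2))).congr_of_eventuallyEq ?_
      filter_upwards [Metric.isOpen_ball.mem_nhds hs] with t' ht'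
      simpa [e'] using (hball t' ht').1.2 (some j)
    have := (hderiv (e j) hs).unique hz
    rwa [sqDistDeriv_apply, mul_eq_zero, or_iff_right two_ne_zero] at this
  | zero => exact zero_dotProduct _
  | add x y _ _ hx hy => rw [add_dotProduct, hx, hy, add_zero]
  | smul c x _ hx => rw [smul_dotProduct, hx, smul_zero]

theorem exists_edgeVec_notMem_rowSpan [Fintype V] [DecidableEq V] {d : ℕ} {q : V → Fin d → ℝ}
    {F F' : Set (Sym2 V)} (h : rankAt d q F < rankAt d q F') :
    ∃ u v, s(u, v) ∈ F' ∧ edgeVec q u v ∉ rowSpan q F := by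
  by_contra! hcon
  refine h.not_ge (Submodule.finrank_mono (Submodule.span_le.mpr ?_))
  rintro _ ⟨u, v, huv, rfl⟩
  exact hcon u v huv

theorem edgeSet_subset_edgeSet_addEdge (G : SimpleGraph V) (x y : V) :
    G.edgeSet ⊆ (addEdge G x y).edgeSet :=
  SimpleGraph.edgeSet_mono le_sup_left

theorem mem_edgeSet_addEdge {G : SimpleGraph V} {x y u v : V}
    (h : s(u, v) ∈ (addEdge G x y).edgeSet) : s(u, v) ∈ G.edgeSet ∨ s(u, v) = s(x, y) := by
  rw [SimpleGraph.mem_edgeSet, addEdge, SimpleGraph.sup_adj, SimpleGraph.fromEdgeSet_adj] at h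
  exact h.imp id fun h => h.1

/-- A motion of `q` preserving the edge lengths of `G` near time `0` and changing the squared length
of `uv` at unit speed gives a flexing of `(G, q)`. -/
theorem exists_isFlexing {d : ℕ} {G : SimpleGraph V} {q : V → Fin d → ℝ} {u v : V}
    {γ : ℝ → V → Fin d → ℝ} (h0 : γ 0 = q) {P : (V → Fin d → ℝ) → Prop}
    (hγ : ∀ᶠ t in 𝓝 0, ContinuousAt γ t ∧
      (∀ a b, G.Adj a b → sqDist (γ t a) (γ t b) = sqDist (q a) (q b)) ∧
      sqDist (γ t u) (γ t v) = sqDist (q u) (q v) + t)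
    (hP : ∀ᶠ t in 𝓝[>] 0, P (γ t)) :
    ∃ φ : Set.Icc (0 : ℝ) 1 → V → Fin d → ℝ, IsFlexing G q φ ∧
      ∀ t : Set.Icc (0 : ℝ) 1, 0 < (t : ℝ) → P (φ t) := by
  obtain ⟨r, hr, hball⟩ := Metric.eventually_nhds_iff.mp
    (hγ.and (eventually_nhdsWithin_iff.mp hP))
  have hε : 0 < r / 2 := half_pos hr
  have hmem (t : Set.Icc (0 : ℝ) 1) : dist (r / 2 * t) 0 < r := by
    rw [Real.dist_0_eq_abs, abs_of_nonneg (mul_nonneg hε.le t.2.1)]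
    nlinarith [t.2.2]
  refine ⟨fun t => γ (r / 2 * t), ⟨?_, by simp [h0], fun t a b hab => ?_, fun t ht hcong => ?_⟩,
    fun t ht => (hball (hmem t)).2 (mul_pos hε ht)⟩
  · rw [continuous_iff_continuousAt]
    intro t
    have : ContinuousAt (fun t : Set.Icc (0 : ℝ) 1 => r / 2 * (t : ℝ)) t := by fun_prop
    exact ContinuousAt.comp (g := γ) (hball (hmem t)).1.1 this
  · exact eDist_eq_eDist_iff.mpr ((hball (hmem t)).1.2.1 a b hab).symm
  · have h1 := eDist_eq_eDist_iff.mp (hcong u v)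
    rw [(hball (hmem t)).1.2.2] at h1
    have := mul_pos hε ht
    linarith

/-- If `{x,y}` is not `d`-linked in `G`, `(G,p)` is generic and `(G,q)` is an
equivalent framework with `d`-dimensional affine span, then `(G,q)` has a flexing
that changes the distance between `x` and `y` away from its value in `(G,p)` for
all positive times. -/
theorem flexing_changes_distance {V : Type*} [Fintype V] [DecidableEq V]
    (d : ℕ) (hd : 1 ≤ d) (G : SimpleGraph V)
    (p : V → Fin d → ℝ) (hp : Generic p) (x y : V)
    (hnl : ¬ IsLinked d G x y)
    (q : V → Fin d → ℝ) (hq : Equivalent G p q)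
    (hspan : affineSpan ℝ (Set.range q) = ⊤) :
    ∃ φ : Set.Icc (0:ℝ) 1 → V → Fin d → ℝ, IsFlexing G q φ ∧
      ∀ t : Set.Icc (0:ℝ) 1, 0 < (t : ℝ) →
        eDist (φ t x) (φ t y) ≠ eDist (p x) (p y) := by
  have hrank : rankAt d q G.edgeSet = rd d G.edgeSet :=
    le_antisymm (rankAt_le_rd _ _)
      ((hp.rankAt_eq_rd _).symm.trans_le (rankAt_le_rankAt_of_equivalent hp hq))
  have hlt : rankAt d q G.edgeSet < rankAt d p (addEdge G x y).edgeSet := by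
    rw [hrank, hp.rankAt_eq_rd]
    refine lt_of_le_of_ne ?_ (Ne.symm hnl)
    rw [← hp.rankAt_eq_rd, ← hp.rankAt_eq_rd]
    exact rankAt_mono p (edgeSet_subset_edgeSet_addEdge G x y)
  by_cases hxy : eDist (p x) (p y) = eDist (q x) (q y)
  · have hq' : Equivalent (addEdge G x y) p q := by
      intro u v huv
      rcases mem_edgeSet_addEdge huv with h | h
      · exact hq u v h
      rcases Sym2.eq_iff.mp h with ⟨rfl, rfl⟩ | ⟨rfl, rfl⟩
      · exact hxy
      · rw [eDist_eq_eDist_iff] at hxy ⊢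
        rwa [sqDist_comm, sqDist_comm (q _)]
    obtain ⟨u, v, huv, hnot⟩ :=
      exists_edgeVec_notMem_rowSpan (hlt.trans_le (rankAt_le_rankAt_of_equivalent hp hq'))
    have hxynot : edgeVec q x y ∉ rowSpan q G.edgeSet := by
      rcases mem_edgeSet_addEdge huv with h | h
      · exact absurd (edgeVec_mem_rowSpan q h) hnot
      rcases Sym2.eq_iff.mp h with ⟨rfl, rfl⟩ | ⟨rfl, rfl⟩
      · exact hnot
      · rwa [edgeVec_comm]
    obtain ⟨γ, h0, hγ⟩ := exists_motion hrank hxynot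
    refine exists_isFlexing (P := fun f => eDist (f x) (f y) ≠ eDist (p x) (p y)) h0 hγ ?_
    filter_upwards [nhdsWithin_le_nhds hγ, self_mem_nhdsWithin] with t ht ht0 heq
    rw [hxy, eDist_eq_eDist_iff, ht.2.2, add_eq_left] at heq
    exact ht0.ne' heq
  · obtain ⟨v₀, w, hQ⟩ := exists_det_frameMatrix_ne_zero hspan
    have huniv := rankAt_univ_le (hp.det_frameMatrix_ne_zero hQ) hQ
    obtain ⟨u, v, -, hnot⟩ := exists_edgeVec_notMem_rowSpan
      (hlt.trans_le ((rankAt_mono p (Set.subset_univ _)).trans huniv))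
    obtain ⟨γ, h0, hγ⟩ := exists_motion hrank hnot
    refine exists_isFlexing (P := fun f => eDist (f x) (f y) ≠ eDist (p x) (p y)) h0 hγ
      (nhdsWithin_le_nhds ?_)
    have hcont : ContinuousAt (fun t => eDist (γ t x) (γ t y)) 0 := by
      have h : Continuous fun f : V → Fin d → ℝ => eDist (f x) (f y) := by
        unfold eDist
        fun_prop
      exact h.continuousAt.comp hγ.self_of_nhds.1
    exact hcont.eventually_ne (by rw [h0]; exact Ne.symm hxy)

end Rigidity
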